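/- arXiv:2312.17068 — 3 statements merged into one kernel-verified Lean document; each statement's English description precedes it below -/
import Mathlib

section
/- SL(2,ℤ) is isomorphic to the amalgamated free product of ℤ/4ℤ and ℤ/6ℤ over ℤ/2ℤ, where ℤ/2ℤ is embedded into ℤ/4ℤ as its unique subgroup of order 2 (generator ↦ twice a generator) and into ℤ/6ℤ as its unique subgroup of order 2 (generator ↦ three times a generator). Equivalently, SL(2,ℤ) has the presentation ⟨S, R | S² = R³, S⁴ = R⁶ = 1⟩, realized by S = [[0, −1], [1, 0]] and R = S·T = [[0, −1], [1, 1]]. -/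
open Matrix MatrixGroups

/-- The two factors `ℤ/4ℤ` and `ℤ/6ℤ` of the amalgamated product, written
multiplicatively, indexed by `Bool`. -/
def amalFactor : Bool → Type
  | true => Multiplicative (ZMod 4)
  | false => Multiplicative (ZMod 6)

instance amalFactorGroup : ∀ b, CommGroup (amalFactor b)
  | true => by unfold amalFactor; infer_instance
  | false => by unfold amalFactor; infer_instance

/-- The embeddings of `ℤ/2ℤ` into `ℤ/4ℤ` (generator ↦ twice a generator) and into
`ℤ/6ℤ` (generator ↦ three times a generator), written multiplicatively. -/
def amalHom : ∀ b, Multiplicative (ZMod 2) →* amalFactor b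
  | true => show Multiplicative (ZMod 2) →* Multiplicative (ZMod 4) from
      AddMonoidHom.toMultiplicative (ZMod.lift 2 ⟨zmultiplesHom (ZMod 4) 2, by decide⟩)
  | false => show Multiplicative (ZMod 2) →* Multiplicative (ZMod 6) from
      AddMonoidHom.toMultiplicative (ZMod.lift 2 ⟨zmultiplesHom (ZMod 6) 3, by decide⟩)

/-- The homomorphism `ℤ/n → G` sending the generator to an element `g` with `g ^ n = 1`. -/
def zmodPowHom {G : Type*} [Group G] (n : ℕ) [NeZero n] (g : G) (hg : g ^ n = 1) :
    Multiplicative (ZMod n) →* G where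
  toFun x := g ^ x.toAdd.val
  map_one' := by simp
  map_mul' x y := by
    rw [toAdd_mul, ZMod.val_add, ← pow_add, ← pow_eq_pow_mod _ hg]

namespace ModularGroup

lemma S_pow_four : S ^ 4 = 1 := by decide

lemma S_mul_T_pow_six : (S * T) ^ 6 = 1 := by decide

lemma S_pow_three_mul_S_mul_T : S ^ 3 * (S * T) = T := by decide

lemma S_pow_three_mul_S_mul_T_sq :
    ((S ^ 3 * (S * T) ^ 2 : SL(2, ℤ)) : Matrix (Fin 2) (Fin 2) ℤ) = !![1, 0; 1, 1] := by decide

end ModularGroup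

open ModularGroup

/-- Products of the elements `s³r` and `s³r²`, which are meant to be mapped to the unipotent
matrices `[[1,1],[0,1]]` and `[[1,0],[1,1]]`. -/
inductive IsPositiveWord {G : Type*} [Group G] (s r : G) : G → Prop
  | one : IsPositiveWord s r 1
  | upper {m : G} : IsPositiveWord s r m → IsPositiveWord s r (s ^ 3 * r * m)
  | lower {m : G} : IsPositiveWord s r m → IsPositiveWord s r (s ^ 3 * r ^ 2 * m)

/-- The form `rⁱ m sʲ` with `i < 3` and `m` a positive word. -/
def HasNormalForm {G : Type*} [Group G] (s r g : G) : Prop :=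
  ∃ i < 3, ∃ m, IsPositiveWord s r m ∧ ∃ j : ℕ, g = r ^ i * m * s ^ j

section NormalForm

variable {G : Type*} [Group G] {s r : G}

lemma commute_sq_of_closure_eq_top (hsr : s ^ 2 = r ^ 3) (hgen : Subgroup.closure {s, r} = ⊤)
    (g : G) : Commute (s ^ 2) g := by
  have h : Subgroup.closure {s, r} ≤ Subgroup.centralizer {s ^ 2} := by
    rw [Subgroup.closure_le]
    rintro x (rfl | rfl) <;> rw [SetLike.mem_coe, Subgroup.mem_centralizer_singleton_iff]
    · exact (Commute.self_pow _ 2).eq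
    · rw [hsr]
      exact (Commute.self_pow _ 3).eq
  have hg : g ∈ Subgroup.centralizer {s ^ 2} := h (hgen ▸ Subgroup.mem_top g)
  exact (Subgroup.mem_centralizer_singleton_iff.mp hg).symm

lemma HasNormalForm.mul_left_r (hsr : s ^ 2 = r ^ 3) (hz : ∀ g, Commute (s ^ 2) g) {g : G}
    (hg : HasNormalForm s r g) : HasNormalForm s r (r * g) := by
  obtain ⟨i, hi, m, hm, j, rfl⟩ := hg
  obtain hi' | rfl : i + 1 < 3 ∨ i = 2 := by omega
  · exact ⟨i + 1, hi', m, hm, j, by simp only [pow_succ', mul_assoc]⟩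
  · refine ⟨0, by norm_num, m, hm, 2 + j, ?_⟩
    calc r * (r ^ 2 * m * s ^ j) = r ^ 3 * m * s ^ j := by group
      _ = _ := by rw [← hsr, (hz m).eq, pow_add]; group

lemma HasNormalForm.mul_left_s (hs : s ^ 4 = 1) (hz : ∀ g, Commute (s ^ 2) g) {g : G}
    (hg : HasNormalForm s r g) : HasNormalForm s r (s * g) := by
  obtain ⟨i, hi, m, hm, j, rfl⟩ := hg
  have push (x : G) : s * (x * m * s ^ j) = s ^ 3 * x * m * s ^ (2 + j) := by
    calc s * (x * m * s ^ j) = s ^ 4 * (s * (x * m * s ^ j)) := by rw [hs, one_mul]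
      _ = s ^ 3 * (s ^ 2 * (x * m)) * s ^ j := by group
      _ = _ := by rw [(hz (x * m)).eq, pow_add]; group
  have cancel (x y : G) : s * (s ^ 3 * x * y) = x * y := by
    rw [mul_assoc, ← mul_assoc s, ← pow_succ', hs, one_mul]
  interval_cases i
  · rw [pow_zero, one_mul]
    cases hm with
    | one => exact ⟨0, by norm_num, 1, .one, j + 1, by simp [pow_succ']⟩
    | @upper m hm => exact ⟨1, by norm_num, m, hm, j, by rw [← mul_assoc, cancel, pow_one]⟩
    | @lower m hm => exact ⟨2, by norm_num, m, hm, j, by rw [← mul_assoc, cancel]⟩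
  · exact ⟨0, by norm_num, _, hm.upper, 2 + j, by rw [push, pow_one, pow_zero, one_mul]⟩
  · exact ⟨0, by norm_num, _, hm.lower, 2 + j, by rw [push, pow_zero, one_mul]⟩

lemma hasNormalForm_of_closure_eq_top (hsr : s ^ 2 = r ^ 3) (hs : s ^ 4 = 1)
    (hgen : Subgroup.closure {s, r} = ⊤) (g : G) : HasNormalForm s r g := by
  have hz := commute_sq_of_closure_eq_top hsr hgen
  have hr : r ^ 6 = 1 := by rw [pow_mul r 3 2, ← hsr, ← pow_mul, hs]
  have iter {x : G} (hx : ∀ g, HasNormalForm s r g → HasNormalForm s r (x * g)) (n : ℕ) {g : G}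
      (hg : HasNormalForm s r g) : HasNormalForm s r (x ^ n * g) := by
    induction n with
    | zero => simpa using hg
    | succ n ih => simpa only [pow_succ', mul_assoc] using hx _ ih
  have hg : g ∈ Subgroup.closure {s, r} := hgen ▸ Subgroup.mem_top g
  induction hg using Subgroup.closure_induction_left with
  | one => exact ⟨0, by norm_num, 1, .one, 0, by simp⟩
  | mul_left x hx y _ ih =>
    rcases hx with rfl | rfl
    · exact ih.mul_left_s hs hz
    · exact ih.mul_left_r hsr hz
  | inv_mul_cancel x hx y _ ih =>
    rcases hx with rfl | rfl
    · rw [inv_eq_of_mul_eq_one_right (b := x ^ 3) (by rw [← pow_succ', hs])]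
      exact iter (fun _ h ↦ h.mul_left_s hs hz) 3 ih
    · rw [inv_eq_of_mul_eq_one_right (b := x ^ 5) (by rw [← pow_succ', hr])]
      exact iter (fun _ h ↦ h.mul_left_r hsr hz) 5 ih

lemma IsPositiveWord.map_apply {f : G →* SL(2, ℤ)} (hfs : f s = S) (hfr : f r = S * T) {m : G}
    (hm : IsPositiveWord s r m) :
    1 ≤ f m 0 0 ∧ 0 ≤ f m 0 1 ∧ 0 ≤ f m 1 0 ∧ 1 ≤ f m 1 1 ∧
      (m = 1 ∨ 1 ≤ f m 0 1 + f m 1 0) := by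
  induction hm with
  | one => simp
  | @upper m _ ih =>
    have h : (f (s ^ 3 * r * m) : Matrix (Fin 2) (Fin 2) ℤ) = !![1, 1; 0, 1] * (f m).1 := by
      rw [map_mul, map_mul, map_pow, hfs, hfr, S_pow_three_mul_S_mul_T,
        ← coe_T]
      rfl
    simp only [h, Matrix.mul_apply, Fin.sum_univ_two, of_apply, cons_val', cons_val_zero,
      cons_val_one, cons_val_fin_one]
    omega
  | @lower m _ ih =>
    have h : (f (s ^ 3 * r ^ 2 * m) : Matrix (Fin 2) (Fin 2) ℤ) = !![1, 0; 1, 1] * (f m).1 := by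
      rw [map_mul, map_mul, map_pow, map_pow, hfs, hfr, ← S_pow_three_mul_S_mul_T_sq]
      rfl
    simp only [h, Matrix.mul_apply, Fin.sum_univ_two, of_apply, cons_val', cons_val_zero,
      cons_val_one, cons_val_fin_one]
    omega

/-- A group generated by `s` and `r` with `s² = r³` and `s⁴ = 1` that maps to `SL(2,ℤ)` by
`s ↦ S` and `r ↦ S * T` is mapped injectively. -/
lemma injective_of_map_eq_S_of_map_eq_S_mul_T (hsr : s ^ 2 = r ^ 3) (hs : s ^ 4 = 1)
    (hgen : Subgroup.closure {s, r} = ⊤) {f : G →* SL(2, ℤ)} (hfs : f s = S)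
    (hfr : f r = S * T) : Function.Injective f := by
  rw [injective_iff_map_eq_one]
  intro g hg
  obtain ⟨i, hi, m, hm, j, rfl⟩ := hasNormalForm_of_closure_eq_top hsr hs hgen g
  rw [pow_eq_pow_mod j hs] at hg ⊢
  have hj : j % 4 < 4 := Nat.mod_lt _ (by norm_num)
  generalize j % 4 = k at hg hj ⊢
  obtain ⟨h00, h01, h10, h11, h⟩ := hm.map_apply hfs hfr
  have hm' : f m = ((S * T) ^ i)⁻¹ * (S ^ k)⁻¹ := by
    rw [map_mul, map_mul, map_pow, map_pow, hfs, hfr] at hg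
    rw [eq_inv_mul_iff_mul_eq, ← mul_eq_one_iff_eq_inv, hg]
  rw [hm'] at h00 h01 h10 h11 h
  have hik : i = 0 ∧ k = 0 := by
    clear h hm' hg
    revert h00 h01 h10 h11
    interval_cases i <;> interval_cases k <;> decide
  obtain ⟨rfl, rfl⟩ := hik
  simpa using h

lemma surjective_of_map_eq_S_of_map_eq_S_mul_T {f : G →* SL(2, ℤ)} (hfs : f s = S)
    (hfr : f r = S * T) : Function.Surjective f := by
  rw [← MonoidHom.range_eq_top, eq_top_iff, ← SpecialLinearGroup.SL2Z_generators,
    Subgroup.closure_le]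
  rintro x (rfl | rfl)
  · exact ⟨s, hfs⟩
  · exact ⟨s⁻¹ * r, by rw [map_mul, map_inv, hfs, hfr, inv_mul_cancel_left]⟩

end NormalForm

/-- The homomorphisms from the factors `ℤ/4ℤ` and `ℤ/6ℤ` to `SL(2,ℤ)` sending the generators to
`S` and `S * T`. -/
def amalFactorToSL2Z : ∀ b, amalFactor b →* SL(2, ℤ)
  | true => zmodPowHom 4 S S_pow_four
  | false => zmodPowHom 6 (S * T) S_mul_T_pow_six

lemma amalFactorToSL2Z_comp_amalHom (b : Bool) :
    (amalFactorToSL2Z b).comp (amalHom b) = zmodPowHom 2 (-1 : SL(2, ℤ)) (by simp) := by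
  refine MonoidHom.ext fun x ↦ ?_
  revert x
  cases b <;> decide

/-- The homomorphism from the amalgamated product to `SL(2,ℤ)`. -/
def amalToSL2Z : Monoid.PushoutI amalHom →* SL(2, ℤ) :=
  Monoid.PushoutI.lift amalFactorToSL2Z _ amalFactorToSL2Z_comp_amalHom

/-- The generator of the factor `ℤ/4ℤ` of the amalgamated product. -/
def amalS : Monoid.PushoutI amalHom :=
  Monoid.PushoutI.of (φ := amalHom) true
    (show amalFactor true from Multiplicative.ofAdd (1 : ZMod 4))

/-- The generator of the factor `ℤ/6ℤ` of the amalgamated product. -/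
def amalR : Monoid.PushoutI amalHom :=
  Monoid.PushoutI.of (φ := amalHom) false
    (show amalFactor false from Multiplicative.ofAdd (1 : ZMod 6))

lemma amalToSL2Z_amalS : amalToSL2Z amalS = S := by
  rw [amalToSL2Z, amalS, Monoid.PushoutI.lift_of]
  decide

lemma amalToSL2Z_amalR : amalToSL2Z amalR = S * T := by
  rw [amalToSL2Z, amalR, Monoid.PushoutI.lift_of]
  decide

lemma amalS_pow_four : amalS ^ 4 = 1 := by
  rw [amalS, ← map_pow, ← map_one (Monoid.PushoutI.of (φ := amalHom) true)]
  rfl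

lemma amalS_sq_eq_amalR_pow_three : amalS ^ 2 = amalR ^ 3 := by
  have hS : amalS ^ 2 = Monoid.PushoutI.base amalHom (Multiplicative.ofAdd 1) := by
    rw [amalS, ← map_pow, ← Monoid.PushoutI.of_apply_eq_base amalHom true]
    rfl
  have hR : amalR ^ 3 = Monoid.PushoutI.base amalHom (Multiplicative.ofAdd 1) := by
    rw [amalR, ← map_pow, ← Monoid.PushoutI.of_apply_eq_base amalHom false]
    rfl
  rw [hS, hR]

lemma exists_pow_eq_amalFactor_true (g : amalFactor true) :
    ∃ n : ℕ, (show amalFactor true from Multiplicative.ofAdd (1 : ZMod 4)) ^ n = g := by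
  have h (x : Multiplicative (ZMod 4)) : Multiplicative.ofAdd (1 : ZMod 4) ^ x.toAdd.val = x := by
    revert x
    decide
  exact ⟨_, h g⟩

lemma exists_pow_eq_amalFactor_false (g : amalFactor false) :
    ∃ n : ℕ, (show amalFactor false from Multiplicative.ofAdd (1 : ZMod 6)) ^ n = g := by
  have h (x : Multiplicative (ZMod 6)) : Multiplicative.ofAdd (1 : ZMod 6) ^ x.toAdd.val = x := by
    revert x
    decide
  exact ⟨_, h g⟩

lemma closure_amalS_amalR : Subgroup.closure {amalS, amalR} = ⊤ := by
  have hS : amalS ∈ Subgroup.closure {amalS, amalR} := Subgroup.subset_closure (by simp)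
  have hR : amalR ∈ Subgroup.closure {amalS, amalR} := Subgroup.subset_closure (by simp)
  have hof (b : Bool) (g : amalFactor b) :
      Monoid.PushoutI.of (φ := amalHom) b g ∈ Subgroup.closure {amalS, amalR} := by
    cases b with
    | true =>
      obtain ⟨n, rfl⟩ := exists_pow_eq_amalFactor_true g
      rw [map_pow]
      exact pow_mem hS n
    | false =>
      obtain ⟨n, rfl⟩ := exists_pow_eq_amalFactor_false g
      rw [map_pow]
      exact pow_mem hR n
  rw [eq_top_iff]
  intro x _
  induction x using Monoid.PushoutI.induction_on with
  | of b g => exact hof b g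
  | base h =>
    rw [← Monoid.PushoutI.of_apply_eq_base amalHom true]
    exact hof true _
  | mul x y hx hy => exact mul_mem (hx trivial) (hy trivial)

/-- `SL(2,ℤ)` is the amalgamated free product `ℤ/4 *_{ℤ/2} ℤ/6`, via an isomorphism
sending the generator of `ℤ/4` to `S = [[0,-1],[1,0]]` and the generator of `ℤ/6` to
`R = S·T = [[0,-1],[1,1]]`. -/
theorem SL2Z_iso_amalgamated_product :
    ∃ e : Monoid.PushoutI amalHom ≃* SL(2, ℤ),
      e (Monoid.PushoutI.of (φ := amalHom) true
          (show amalFactor true from Multiplicative.ofAdd (1 : ZMod 4))) =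
          ModularGroup.S ∧
      e (Monoid.PushoutI.of (φ := amalHom) false
          (show amalFactor false from Multiplicative.ofAdd (1 : ZMod 6))) =
          ModularGroup.S * ModularGroup.T := by
  exact ⟨MulEquiv.ofBijective amalToSL2Z
    ⟨injective_of_map_eq_S_of_map_eq_S_mul_T amalS_sq_eq_amalR_pow_three amalS_pow_four
      closure_amalS_amalR amalToSL2Z_amalS amalToSL2Z_amalR,
    surjective_of_map_eq_S_of_map_eq_S_mul_T amalToSL2Z_amalS amalToSL2Z_amalR⟩,
    amalToSL2Z_amalS, amalToSL2Z_amalR⟩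
end

section
/- The quotient group PSL(2,ℤ) := SL(2,ℤ)/{±I} is isomorphic to the free product (ℤ/2ℤ) * (ℤ/3ℤ) of a cyclic group of order 2 and a cyclic group of order 3. -/
open Matrix MatrixGroups

/-- The subgroup `{±I}` of `SL(2,ℤ)` is normal (it is central), so that the quotient
`PSL(2,ℤ) = SL(2,ℤ)/{±I}` is a group. -/
instance negOne_zpowers_normal : (Subgroup.zpowers (-1 : SL(2, ℤ))).Normal := by
  constructor
  intro n hn g
  have hc : ∀ h : SL(2, ℤ), n * h = h * n := by
    obtain ⟨k, rfl⟩ := Subgroup.mem_zpowers_iff.mp hn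
    intro h
    have h1 : (-1 : SL(2, ℤ)) * h = h * (-1) := by
      ext i j; simp [Matrix.SpecialLinearGroup.coe_mul]
    exact Commute.zpow_left h1 k
  rw [← hc g, mul_assoc, mul_inv_cancel, mul_one]
  exact hn

open scoped Pointwise

namespace Monoid.Coprod

theorem lift_injective_of_coprodI_lift_injective {H : Bool → Type*} [∀ b, Monoid (H b)]
    {G : Type*} [Monoid G] (F : ∀ b, H b →* G) (hF : Function.Injective (CoprodI.lift F)) :
    Function.Injective (lift (F true) (F false)) := by
  let toI : Monoid.Coprod (H true) (H false) →* CoprodI H := lift CoprodI.of CoprodI.of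
  let J : ∀ b, H b →* Monoid.Coprod (H true) (H false) := fun b => b.rec inr inl
  let ofI : CoprodI H →* Monoid.Coprod (H true) (H false) := CoprodI.lift J
  have hinv : ofI.comp toI = MonoidHom.id _ :=
    hom_ext (MonoidHom.ext fun x => CoprodI.lift_of J x)
      (MonoidHom.ext fun x => CoprodI.lift_of J x)
  have hlift : lift (F true) (F false) = (CoprodI.lift F).comp toI :=
    (hom_ext (MonoidHom.ext fun x => CoprodI.lift_of F x)
      (MonoidHom.ext fun x => CoprodI.lift_of F x)).symm
  have htoI : Function.Injective toI :=
    Function.LeftInverse.injective (g := ofI) (DFunLike.congr_fun hinv)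
  rw [hlift, MonoidHom.coe_comp]
  exact hF.comp htoI

/-- The **ping-pong lemma** for the free product of two groups. -/
theorem lift_injective_of_ping_pong {H : Bool → Type*} [∀ b, Group (H b)] {G α : Type*} [Group G]
    [MulAction G α] (F : ∀ b, H b →* G) (hcard : ∃ b, 3 ≤ Cardinal.mk (H b)) {X : Bool → Set α}
    (hX : ∀ b, (X b).Nonempty) (hdisj : Disjoint (X true) (X false))
    (htrue : ∀ h ≠ 1, F true h • X false ⊆ X true)
    (hfalse : ∀ h ≠ 1, F false h • X true ⊆ X false) :
    Function.Injective (lift (F true) (F false)) := by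
  refine lift_injective_of_coprodI_lift_injective F
    (CoprodI.lift_injective_of_ping_pong F (Or.inr hcard) X hX ?_ ?_)
  · rintro (_ | _) (_ | _) h
    exacts [absurd rfl h, hdisj.symm, hdisj, absurd rfl h]
  · rintro (_ | _) (_ | _) h
    exacts [absurd rfl h, hfalse, htrue, absurd rfl h]

end Monoid.Coprod

/-- The homomorphism from the cyclic group of order `n` sending the generator to an element `g`
with `g ^ n = 1`. -/
def zmodPowersHom {G : Type*} [Group G] (n : ℕ) (g : G) (hg : g ^ n = 1) :
    Multiplicative (ZMod n) →* G :=
  AddMonoidHom.toMultiplicativeLeft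
    (ZMod.lift n ⟨zmultiplesHom _ (Additive.ofMul g), by simp [← ofMul_pow, hg]⟩)

theorem zmodPowersHom_ofAdd_natCast {G : Type*} [Group G] (n : ℕ) (g : G) (hg : g ^ n = 1)
    (k : ℕ) : zmodPowersHom n g hg (Multiplicative.ofAdd (k : ZMod n)) = g ^ k := by
  have h := ZMod.lift_coe n
    ⟨zmultiplesHom _ (Additive.ofMul g), by simp [← ofMul_pow, hg]⟩ (k : ℤ)
  rw [Int.cast_natCast] at h
  simp [zmodPowersHom, h]

/-- The quotient `SL(2,ℤ)/{±I}`. -/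
abbrev PSL2Z := SL(2, ℤ) ⧸ Subgroup.zpowers (-1 : SL(2, ℤ))

namespace PSL2Z

/-- The matrix `R = [[0, -1], [1, 1]]`, of order three modulo `±I`. -/
def R : SL(2, ℤ) := ⟨!![0, -1; 1, 1], by simp [Matrix.det_fin_two]⟩

theorem coe_R : (R : Matrix (Fin 2) (Fin 2) ℤ) = !![0, -1; 1, 1] := rfl

theorem coe_R_sq : ((R ^ 2 : SL(2, ℤ)) : Matrix (Fin 2) (Fin 2) ℤ) = !![-1, -1; 1, 0] := by
  decide

theorem mem_zpowers_neg_one {g : SL(2, ℤ)} :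
    g ∈ Subgroup.zpowers (-1 : SL(2, ℤ)) ↔ g = 1 ∨ g = -1 := by
  constructor
  · rintro ⟨k, rfl⟩
    rcases Int.even_or_odd k with h | h
    · exact Or.inl h.neg_one_zpow
    · exact Or.inr h.neg_one_zpow
  · rintro (rfl | rfl)
    · exact one_mem _
    · exact Subgroup.mem_zpowers _

theorem mk_neg (g : SL(2, ℤ)) : ((-g : SL(2, ℤ)) : PSL2Z) = g := by
  rw [QuotientGroup.eq, mem_zpowers_neg_one]
  right
  simp

/-- The product of the two entries of the first column, as a function on `SL(2,ℤ)/{±I}`. -/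
def colProd (q : PSL2Z) : ℤ :=
  Quotient.liftOn' q
    (fun g => (g : Matrix (Fin 2) (Fin 2) ℤ) 0 0 * (g : Matrix (Fin 2) (Fin 2) ℤ) 1 0)
    fun a b h => by
    rw [QuotientGroup.leftRel_apply, mem_zpowers_neg_one] at h
    rcases h with h | h
    · rw [inv_mul_eq_one.mp h]
    · rw [inv_mul_eq_iff_eq_mul.mp h]
      simp

@[simp]
theorem colProd_mk (g : SL(2, ℤ)) : colProd (g : PSL2Z) =
    (g : Matrix (Fin 2) (Fin 2) ℤ) 0 0 * (g : Matrix (Fin 2) (Fin 2) ℤ) 1 0 := rfl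

theorem mk_S_sq : ((ModularGroup.S : SL(2, ℤ)) : PSL2Z) ^ 2 = 1 := by
  rw [← QuotientGroup.mk_pow, QuotientGroup.eq_one_iff, mem_zpowers_neg_one]
  right; decide

theorem mk_R_cube : ((R : SL(2, ℤ)) : PSL2Z) ^ 3 = 1 := by
  rw [← QuotientGroup.mk_pow, QuotientGroup.eq_one_iff, mem_zpowers_neg_one]
  right; decide

theorem mk_T : ((ModularGroup.T : SL(2, ℤ)) : PSL2Z) = ModularGroup.S * R := by
  rw [← QuotientGroup.mk_mul, ← mk_neg (ModularGroup.S * R)]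
  congr 1
  decide

theorem closure_mk_S_mk_R :
    Subgroup.closure {((ModularGroup.S : SL(2, ℤ)) : PSL2Z), (R : PSL2Z)} = ⊤ := by
  rw [eq_top_iff, ← MonoidHom.range_eq_top.mpr (QuotientGroup.mk'_surjective
    (Subgroup.zpowers (-1 : SL(2, ℤ)))), MonoidHom.range_eq_map,
    ← SpecialLinearGroup.SL2Z_generators, MonoidHom.map_closure, Subgroup.closure_le]
  have hS := Subgroup.subset_closure
    (Set.mem_insert ((ModularGroup.S : SL(2, ℤ)) : PSL2Z) {(R : PSL2Z)})
  have hR := Subgroup.subset_closure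
    (Set.mem_insert_of_mem ((ModularGroup.S : SL(2, ℤ)) : PSL2Z) (Set.mem_singleton (R : PSL2Z)))
  rintro _ ⟨g, rfl | rfl, rfl⟩
  · exact hS
  · rw [QuotientGroup.mk'_apply, mk_T]
    exact mul_mem hS hR

theorem colProd_S_mul_pos {q : PSL2Z} (hq : colProd q < 0) :
    0 < colProd ((ModularGroup.S : SL(2, ℤ)) * q) := by
  induction q using QuotientGroup.induction_on with
  | H g =>
    rw [← QuotientGroup.mk_mul, colProd_mk, Matrix.SpecialLinearGroup.coe_mul, ModularGroup.coe_S]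
    rw [colProd_mk] at hq
    simp only [Matrix.mul_apply, Fin.sum_univ_two, Matrix.of_apply, Matrix.cons_val',
      Matrix.cons_val_zero, Matrix.cons_val_one]
    linarith

theorem colProd_R_mul_neg {q : PSL2Z} (hq : 0 < colProd q) : colProd (R * q) < 0 := by
  induction q using QuotientGroup.induction_on with
  | H g =>
    rw [← QuotientGroup.mk_mul, colProd_mk, Matrix.SpecialLinearGroup.coe_mul, coe_R]
    rw [colProd_mk] at hq
    simp only [Matrix.mul_apply, Fin.sum_univ_two, Matrix.of_apply, Matrix.cons_val',
      Matrix.cons_val_zero, Matrix.cons_val_one]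
    nlinarith [sq_nonneg (g.1 1 0)]

theorem colProd_R_sq_mul_neg {q : PSL2Z} (hq : 0 < colProd q) :
    colProd ((R : PSL2Z) ^ 2 * q) < 0 := by
  induction q using QuotientGroup.induction_on with
  | H g =>
    rw [← QuotientGroup.mk_pow, ← QuotientGroup.mk_mul, colProd_mk,
      Matrix.SpecialLinearGroup.coe_mul, coe_R_sq]
    rw [colProd_mk] at hq
    simp only [Matrix.mul_apply, Fin.sum_univ_two, Matrix.of_apply, Matrix.cons_val',
      Matrix.cons_val_zero, Matrix.cons_val_one]
    nlinarith [sq_nonneg (g.1 0 0)]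

theorem zmodPowersHom_S_smul_subset (m : Multiplicative (ZMod 2)) (hm : m ≠ 1) :
    zmodPowersHom 2 _ mk_S_sq m • {q | colProd q < 0} ⊆ {q | 0 < colProd q} := by
  rintro _ ⟨q, hq, rfl⟩
  obtain rfl : m = Multiplicative.ofAdd ((1 : ℕ) : ZMod 2) := by
    revert m; decide
  simp only [zmodPowersHom_ofAdd_natCast, pow_one]
  exact colProd_S_mul_pos hq

theorem zmodPowersHom_R_smul_subset (n : Multiplicative (ZMod 3)) (hn : n ≠ 1) :
    zmodPowersHom 3 _ mk_R_cube n • {q | 0 < colProd q} ⊆ {q | colProd q < 0} := by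
  rintro _ ⟨q, hq, rfl⟩
  obtain rfl | rfl : n = Multiplicative.ofAdd ((1 : ℕ) : ZMod 3) ∨
      n = Multiplicative.ofAdd ((2 : ℕ) : ZMod 3) := by
    revert n; decide
  · simp only [zmodPowersHom_ofAdd_natCast, pow_one]
    exact colProd_R_mul_neg hq
  · simp only [zmodPowersHom_ofAdd_natCast]
    exact colProd_R_sq_mul_neg hq

/-- The homomorphism from the free product sending the two generators to the classes of `S`
and `R`. -/
def ofCoprod : Monoid.Coprod (Multiplicative (ZMod 2)) (Multiplicative (ZMod 3)) →* PSL2Z :=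
  Monoid.Coprod.lift (zmodPowersHom 2 _ mk_S_sq) (zmodPowersHom 3 _ mk_R_cube)

theorem ofCoprod_injective : Function.Injective ofCoprod := by
  let F (b : Bool) : Multiplicative (ZMod (cond b 2 3)) →* PSL2Z :=
    b.rec (zmodPowersHom 3 _ mk_R_cube) (zmodPowersHom 2 _ mk_S_sq)
  let X (b : Bool) : Set PSL2Z := cond b {q | 0 < colProd q} {q | colProd q < 0}
  have hpos : 0 < colProd ((ModularGroup.S * R⁻¹ : SL(2, ℤ)) : PSL2Z) := by
    rw [colProd_mk]
    decide
  have hneg : colProd ((R ^ 2 * ModularGroup.S * R⁻¹ : SL(2, ℤ)) : PSL2Z) < 0 := by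
    rw [colProd_mk]
    decide
  refine Monoid.Coprod.lift_injective_of_ping_pong F (X := X) ⟨false, ?_⟩ ?_ ?_ ?_ ?_
  · simp [Cardinal.mk_fintype, ZMod.card]
  · rintro (_ | _)
    exacts [⟨_, hneg⟩, ⟨_, hpos⟩]
  · exact Set.disjoint_left.mpr fun q (h : 0 < colProd q) (h' : colProd q < 0) => h.not_gt h'
  · exact zmodPowersHom_S_smul_subset
  · exact zmodPowersHom_R_smul_subset

theorem ofCoprod_surjective : Function.Surjective ofCoprod := by
  rw [← MonoidHom.range_eq_top, eq_top_iff, ← closure_mk_S_mk_R, Subgroup.closure_le]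
  rintro _ (rfl | rfl)
  · refine ⟨Monoid.Coprod.inl (Multiplicative.ofAdd ((1 : ℕ) : ZMod 2)), ?_⟩
    rw [ofCoprod, Monoid.Coprod.lift_apply_inl, zmodPowersHom_ofAdd_natCast, pow_one]
  · refine ⟨Monoid.Coprod.inr (Multiplicative.ofAdd ((1 : ℕ) : ZMod 3)), ?_⟩
    rw [ofCoprod, Monoid.Coprod.lift_apply_inr, zmodPowersHom_ofAdd_natCast, pow_one]

end PSL2Z

/-- `PSL(2,ℤ) = SL(2,ℤ)/{±I}` is isomorphic to the free product `(ℤ/2ℤ) * (ℤ/3ℤ)`. -/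
theorem PSL2Z_iso_free_product :
    Nonempty ((SL(2, ℤ) ⧸ Subgroup.zpowers (-1 : SL(2, ℤ))) ≃*
      Monoid.Coprod (Multiplicative (ZMod 2)) (Multiplicative (ZMod 3))) := by
  exact ⟨(MulEquiv.ofBijective PSL2Z.ofCoprod
    ⟨PSL2Z.ofCoprod_injective, PSL2Z.ofCoprod_surjective⟩).symm⟩
end

section
/- The stabilizer of the point i in SL(2,ℤ) under the Möbius action is the cyclic subgroup of order 4 generated by S = [[0, −1], [1, 0]], and the stabilizer of the point e^{iπ/3} is a cyclic subgroup of order 6, generated by the matrix [[1, −1], [1, 0]]. Likewise the stabilizer of e^{2πi/3} is cyclic of order 6, generated by [[1, 1], [−1, 0]]. -/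
open Matrix MatrixGroups UpperHalfPlane

/-- The point `e^{iπ/3}` of the upper half-plane. -/
noncomputable def expPiMulIDivThree : ℍ :=
  ⟨Complex.exp ((Real.pi : ℂ) * Complex.I / 3), by
    have h : (Real.pi : ℂ) * Complex.I / 3 = ((Real.pi / 3 : ℝ) : ℂ) * Complex.I := by
      push_cast; ring
    show 0 < (Complex.exp ((Real.pi : ℂ) * Complex.I / 3)).im
    rw [h, Complex.exp_ofReal_mul_I_im]
    exact Real.sin_pos_of_pos_of_lt_pi (by positivity) (by linarith [Real.pi_pos])⟩

/-- The point `e^{2iπ/3}` of the upper half-plane. -/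
noncomputable def expTwoPiMulIDivThree : ℍ :=
  ⟨Complex.exp (2 * (Real.pi : ℂ) * Complex.I / 3), by
    have h : 2 * (Real.pi : ℂ) * Complex.I / 3 = ((2 * Real.pi / 3 : ℝ) : ℂ) * Complex.I := by
      push_cast; ring
    show 0 < (Complex.exp (2 * (Real.pi : ℂ) * Complex.I / 3)).im
    rw [h, Complex.exp_ofReal_mul_I_im]
    exact Real.sin_pos_of_pos_of_lt_pi (by positivity) (by linarith [Real.pi_pos])⟩

/-- The matrix `[[1,-1],[1,0]]` as an element of `SL(2,ℤ)`. -/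
def matFixExpPiDivThree : SL(2, ℤ) :=
  ⟨!![1, -1; 1, 0], by norm_num [Matrix.det_fin_two_of]⟩

/-- The matrix `[[1,1],[-1,0]]` as an element of `SL(2,ℤ)`. -/
def matFixExpTwoPiDivThree : SL(2, ℤ) :=
  ⟨!![1, 1; -1, 0], by norm_num [Matrix.det_fin_two_of]⟩

theorem smul_eq_self_iff_of_sq_eq {z : ℍ} {t : ℤ} (hz : (z : ℂ) ^ 2 = t * z - 1)
    (g : SL(2, ℤ)) :
    g • z = z ↔ g 0 0 = t * g 1 0 + g 1 1 ∧ g 0 1 = -g 1 0 := by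
  have hd : ((g 1 0 : ℤ) : ℂ) * z + (g 1 1 : ℤ) ≠ 0 := by
    simpa [UpperHalfPlane.denom] using
      UpperHalfPlane.denom_ne_zero (g : GL (Fin 2) ℝ) z
  rw [UpperHalfPlane.ext_iff, coe_specialLinearGroup_apply]
  simp only [algebraMap_int_eq, eq_intCast, Complex.ofReal_intCast]
  rw [div_eq_iff hd]
  constructor
  · intro h
    have key : ((g 0 0 - t * g 1 0 - g 1 1 : ℤ) : ℂ) * z + ((g 0 1 + g 1 0 : ℤ) : ℂ) = 0 := by
      push_cast
      linear_combination h + (g 1 0 : ℂ) * hz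
    have him : g 0 0 - t * g 1 0 - g 1 1 = 0 := by
      have := congrArg Complex.im key
      simp only [Complex.add_im, Complex.mul_im, Complex.intCast_re, Complex.intCast_im,
        zero_mul, add_zero, Complex.zero_im] at this
      exact_mod_cast (mul_eq_zero.mp this).resolve_right z.im_pos.ne'
    rw [him, Int.cast_zero, zero_mul, zero_add, Int.cast_eq_zero] at key
    constructor <;> linarith
  · rintro ⟨ha, hb⟩
    rw [ha, hb]
    push_cast
    linear_combination -(g 1 0 : ℂ) * hz

theorem stabilizer_eq_zpowers_of_sq_eq {z : ℍ} {t : ℤ} (hz : (z : ℂ) ^ 2 = t * z - 1)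
    {M : SL(2, ℤ)} (hM : M 0 0 = t * M 1 0 + M 1 1 ∧ M 0 1 = -M 1 0)
    (hpow : ∀ c d : ℤ, d ^ 2 + t * c * d + c ^ 2 = 1 →
      ∃ k : ℕ, (M ^ k) 1 0 = c ∧ (M ^ k) 1 1 = d) :
    MulAction.stabilizer SL(2, ℤ) z = Subgroup.zpowers M := by
  have hMz : M ∈ MulAction.stabilizer SL(2, ℤ) z := (smul_eq_self_iff_of_sq_eq hz M).2 hM
  refine le_antisymm (fun g hg ↦ ?_) (Subgroup.zpowers_le.2 hMz)
  obtain ⟨ha, hb⟩ := (smul_eq_self_iff_of_sq_eq hz g).1 hg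
  have hdet := g.det_coe
  rw [Matrix.det_fin_two, ha, hb] at hdet
  obtain ⟨k, hc, hd⟩ := hpow (g 1 0) (g 1 1) (by linear_combination hdet)
  obtain ⟨ha', hb'⟩ := (smul_eq_self_iff_of_sq_eq hz (M ^ k)).1 (pow_mem hMz k)
  have : M ^ k = g := by
    ext i j
    fin_cases i <;> fin_cases j
    · simpa [hc, hd, ha] using ha'
    · simpa [hc, hb] using hb'
    · exact hc
    · exact hd
  exact this ▸ Subgroup.npow_mem_zpowers M k

theorem coe_expPiMulIDivThree :
    (expPiMulIDivThree : ℂ) = ⟨1 / 2, √3 / 2⟩ := by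
  have h : (Real.pi : ℂ) * Complex.I / 3 = ((Real.pi / 3 : ℝ) : ℂ) * Complex.I := by
    push_cast; ring
  change Complex.exp ((Real.pi : ℂ) * Complex.I / 3) = _
  rw [h]
  apply Complex.ext
  · rw [Complex.exp_ofReal_mul_I_re, Real.cos_pi_div_three]
  · rw [Complex.exp_ofReal_mul_I_im, Real.sin_pi_div_three]

theorem expPiMulIDivThree_sq :
    (expPiMulIDivThree : ℂ) ^ 2 = (1 : ℤ) * expPiMulIDivThree - 1 := by
  have h3 : √3 * √3 = 3 := Real.mul_self_sqrt (by norm_num)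
  rw [coe_expPiMulIDivThree, sq]
  apply Complex.ext
  · simp; linarith
  · simp; ring

theorem expTwoPiMulIDivThree_sq :
    (expTwoPiMulIDivThree : ℂ) ^ 2 = (-1 : ℤ) * expTwoPiMulIDivThree - 1 := by
  have h : (expTwoPiMulIDivThree : ℂ) = (expPiMulIDivThree : ℂ) ^ 2 := by
    change Complex.exp _ = Complex.exp _ ^ 2
    rw [← Complex.exp_nat_mul]
    congr 1
    push_cast
    ring
  have h1 := expPiMulIDivThree_sq
  push_cast at h1 ⊢
  rw [h]
  linear_combination ((expPiMulIDivThree : ℂ) ^ 2 + expPiMulIDivThree + 1) * h1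

theorem exists_pow_S_row_eq (c d : ℤ) (h : d ^ 2 + 0 * c * d + c ^ 2 = 1) :
    ∃ k : ℕ, (ModularGroup.S ^ k) 1 0 = c ∧ (ModularGroup.S ^ k) 1 1 = d := by
  have : -1 ≤ c := by nlinarith
  have : c ≤ 1 := by nlinarith
  have : -1 ≤ d := by nlinarith
  have : d ≤ 1 := by nlinarith
  interval_cases c <;> interval_cases d <;> first
    | omega
    | exact ⟨0, by decide⟩
    | exact ⟨1, by decide⟩
    | exact ⟨2, by decide⟩
    | exact ⟨3, by decide⟩

theorem exists_pow_matFixExpPiDivThree_row_eq (c d : ℤ)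
    (h : d ^ 2 + 1 * c * d + c ^ 2 = 1) :
    ∃ k : ℕ, (matFixExpPiDivThree ^ k) 1 0 = c ∧ (matFixExpPiDivThree ^ k) 1 1 = d := by
  have : -1 ≤ c := by nlinarith [sq_nonneg (2 * d + c)]
  have : c ≤ 1 := by nlinarith [sq_nonneg (2 * d + c)]
  have : -1 ≤ d := by nlinarith [sq_nonneg (2 * c + d)]
  have : d ≤ 1 := by nlinarith [sq_nonneg (2 * c + d)]
  interval_cases c <;> interval_cases d <;> first
    | omega
    | exact ⟨0, by decide⟩
    | exact ⟨1, by decide⟩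
    | exact ⟨2, by decide⟩
    | exact ⟨3, by decide⟩
    | exact ⟨4, by decide⟩
    | exact ⟨5, by decide⟩

theorem exists_pow_matFixExpTwoPiDivThree_row_eq (c d : ℤ)
    (h : d ^ 2 + -1 * c * d + c ^ 2 = 1) :
    ∃ k : ℕ, (matFixExpTwoPiDivThree ^ k) 1 0 = c ∧
      (matFixExpTwoPiDivThree ^ k) 1 1 = d := by
  have : -1 ≤ c := by nlinarith [sq_nonneg (2 * d - c)]
  have : c ≤ 1 := by nlinarith [sq_nonneg (2 * d - c)]
  have : -1 ≤ d := by nlinarith [sq_nonneg (2 * c - d)]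
  have : d ≤ 1 := by nlinarith [sq_nonneg (2 * c - d)]
  interval_cases c <;> interval_cases d <;> first
    | omega
    | exact ⟨0, by decide⟩
    | exact ⟨1, by decide⟩
    | exact ⟨2, by decide⟩
    | exact ⟨3, by decide⟩
    | exact ⟨4, by decide⟩
    | exact ⟨5, by decide⟩

/-- The stabilizer of `i` in `SL(2,ℤ)` is the cyclic group of order 4 generated by
`S = [[0,-1],[1,0]]`; the stabilizer of `e^{iπ/3}` is the cyclic group of order 6
generated by `[[1,-1],[1,0]]`; and the stabilizer of `e^{2iπ/3}` is the cyclic group of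
order 6 generated by `[[1,1],[-1,0]]`. -/
theorem stabilizers_of_special_points :
    (MulAction.stabilizer SL(2, ℤ) UpperHalfPlane.I = Subgroup.zpowers ModularGroup.S ∧
      orderOf ModularGroup.S = 4) ∧
    (MulAction.stabilizer SL(2, ℤ) expPiMulIDivThree =
        Subgroup.zpowers matFixExpPiDivThree ∧
      orderOf matFixExpPiDivThree = 6) ∧
    (MulAction.stabilizer SL(2, ℤ) expTwoPiMulIDivThree =
        Subgroup.zpowers matFixExpTwoPiDivThree ∧
      orderOf matFixExpTwoPiDivThree = 6) := by
  refine ⟨⟨?_, ?_⟩, ⟨?_, ?_⟩, ?_, ?_⟩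
  · exact stabilizer_eq_zpowers_of_sq_eq (t := 0) (by simp) (by decide) exists_pow_S_row_eq
  · exact (orderOf_eq_iff (by norm_num)).2 ⟨by decide, by decide⟩
  · exact stabilizer_eq_zpowers_of_sq_eq expPiMulIDivThree_sq (by decide)
      exists_pow_matFixExpPiDivThree_row_eq
  · exact (orderOf_eq_iff (by norm_num)).2 ⟨by decide, by decide⟩
  · exact stabilizer_eq_zpowers_of_sq_eq expTwoPiMulIDivThree_sq (by decide)
      exists_pow_matFixExpTwoPiDivThree_row_eq
  · exact (orderOf_eq_iff (by norm_num)).2 ⟨by decide, by decide⟩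
end
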